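/- arXiv:1112.1892 — 6 statements merged into one kernel-verified Lean document; each statement's English description precedes it below -/
import Mathlib

section
/- Consider the power control subproblem of a single base station: a finite set S of mobiles, where mobile i has power gain h_i > 0, target SINR γ_i > 0, and load β_i = γ_i/(1+γ_i), and the receiver noise power is σ² > 0. A power vector p : S → ℝ with p_i > 0 for all i is feasible if h_i p_i / (Σ_{l ∈ S, l ≠ i} h_l p_l + σ²) ≥ γ_i for every i ∈ S. Then a feasible power vector exists if and only if Σ_{l ∈ S} β_l < 1. -/
open scoped BigOperators

/-- A power vector `p` is feasible for the single base station power control problem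
with noise power `σ2`, target SINRs `γ` and gains `h` if every power is positive and
every mobile's SINR requirement `h i * p i / (∑_{l ≠ i} h l * p l + σ2) ≥ γ i` holds. -/
def FeasiblePow {S : Type*} [Fintype S] [DecidableEq S]
    (σ2 : ℝ) (γ h : S → ℝ) (p : S → ℝ) : Prop :=
  (∀ i, 0 < p i) ∧
  ∀ i, γ i ≤ h i * p i / ((∑ l ∈ Finset.univ.erase i, h l * p l) + σ2)

/-- A feasible power vector exists iff the total load `∑ β_l = ∑ γ_l/(1+γ_l)` is below 1. -/
theorem feasible_power_exists_iff {S : Type*} [Fintype S] [DecidableEq S]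
    (σ2 : ℝ) (hσ : 0 < σ2) (γ h : S → ℝ)
    (hγ : ∀ i, 0 < γ i) (hh : ∀ i, 0 < h i) :
    (∃ p : S → ℝ, FeasiblePow σ2 γ h p) ↔ (∑ l, γ l / (1 + γ l)) < 1 := by
  have hb : ∀ i, 0 < 1 + γ i := fun i => by linarith [hγ i]
  constructor
  · rintro ⟨p, hp, hf⟩
    have hx : ∀ i, 0 < h i * p i := fun i => mul_pos (hh i) (hp i)
    have hX : 0 ≤ ∑ l, h l * p l := Finset.sum_nonneg fun i _ => (hx i).le
    have key : ∀ i, γ i / (1 + γ i) * ((∑ l, h l * p l) + σ2) ≤ h i * p i := by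
      intro i
      have h1 := hf i
      have h2 := Finset.add_sum_erase Finset.univ (fun l => h l * p l) (Finset.mem_univ i)
      have h3 : 0 ≤ ∑ l ∈ Finset.univ.erase i, h l * p l :=
        Finset.sum_nonneg fun i _ => (hx i).le
      rw [le_div_iff₀ (by linarith)] at h1
      rw [div_mul_eq_mul_div, div_le_iff₀ (hb i), ← h2]
      nlinarith
    have hs := Finset.sum_le_sum fun i (_ : i ∈ Finset.univ) => key i
    rw [← Finset.sum_mul] at hs
    by_contra hc
    push Not at hc
    nlinarith
  · intro hB
    set B := ∑ l, γ l / (1 + γ l) with hBdef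
    have hB' : 0 < 1 - B := by linarith
    set T := σ2 / (1 - B) with hT
    have hTp : 0 < T := div_pos hσ hB'
    have hTe : B * T + σ2 = T := by
      rw [hT]; field_simp; ring
    have hx : ∀ l, h l * (γ l / (1 + γ l) * T / h l) = γ l / (1 + γ l) * T := fun l =>
      mul_div_cancel₀ _ (hh l).ne'
    refine ⟨fun i => γ i / (1 + γ i) * T / h i, fun i =>
      div_pos (mul_pos (div_pos (hγ i) (hb i)) hTp) (hh i), fun i => ?_⟩
    simp only [hx]
    have h2 := Finset.add_sum_erase Finset.univ (fun l => γ l / (1 + γ l) * T) (Finset.mem_univ i)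
    have h6 : ∑ l, γ l / (1 + γ l) * T = B * T := by rw [hBdef, Finset.sum_mul]
    rw [h6] at h2
    have h4 : (∑ l ∈ Finset.univ.erase i, γ l / (1 + γ l) * T) + σ2 = T / (1 + γ i) := by
      have h5 : T / (1 + γ i) = T - γ i / (1 + γ i) * T := by
        have := (hb i).ne'
        field_simp; ring
      linarith
    rw [h4, le_div_iff₀ (div_pos hTp (hb i))]
    apply le_of_eq
    ring
end

section
/- Consider the power control subproblem of a single base station with a finite set S of mobiles, gains h_i > 0, targets γ_i > 0, loads β_i = γ_i/(1+γ_i), and noise power σ² > 0, and assume Σ_{l ∈ S} β_l < 1. Define p* by p*_i = (σ²/h_i) · β_i / (1 − Σ_{l ∈ S} β_l). Then p* is a feasible power vector, every feasible power vector q satisfies q_i ≥ p*_i for all i ∈ S, and consequently p* is the unique Pareto efficient feasible power vector (i.e., the unique feasible p such that no feasible q satisfies q_i ≤ p_i for all i with strict inequality for some i). -/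
open scoped BigOperators

/-- `p` is Pareto efficient if it is feasible and no feasible `q` satisfies `q ≤ p`
componentwise with strict inequality somewhere. -/
def ParetoEffPow {S : Type*} [Fintype S] [DecidableEq S]
    (σ2 : ℝ) (γ h : S → ℝ) (p : S → ℝ) : Prop :=
  FeasiblePow σ2 γ h p ∧
  ¬ ∃ q : S → ℝ, FeasiblePow σ2 γ h q ∧ (∀ i, q i ≤ p i) ∧ (∃ i, q i < p i)

theorem feasiblePow_iff_aux {S : Type*} [Fintype S] [DecidableEq S]
    (σ2 : ℝ) (hσ : 0 < σ2) (γ h : S → ℝ)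
    (hγ : ∀ i, 0 < γ i) (hh : ∀ i, 0 < h i) (p : S → ℝ) (hp : ∀ i, 0 < p i) :
    FeasiblePow σ2 γ h p ↔ ∀ i, γ i / (1 + γ i) * ((∑ l, h l * p l) + σ2) ≤ h i * p i := by
  unfold FeasiblePow
  rw [and_iff_right hp]
  refine forall_congr' fun i => ?_
  have e := Finset.add_sum_erase Finset.univ (fun l => h l * p l) (Finset.mem_univ i)
  have hn : 0 ≤ ∑ l ∈ Finset.univ.erase i, h l * p l :=
    Finset.sum_nonneg fun l _ => (mul_pos (hh l) (hp l)).le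
  rw [← e, le_div_iff₀ (by linarith), div_mul_eq_mul_div,
    div_le_iff₀ (by linarith [hγ i])]
  constructor <;> intro H <;> nlinarith

/-- When `∑ β_l < 1`, the power vector `p*_i = (σ²/h_i)·β_i/(1 − ∑ β_l)` is feasible,
it is a componentwise lower bound on every feasible power vector, and it is the unique
Pareto efficient feasible power vector. -/
theorem pareto_power_unique {S : Type*} [Fintype S] [DecidableEq S]
    (σ2 : ℝ) (hσ : 0 < σ2) (γ h : S → ℝ)
    (hγ : ∀ i, 0 < γ i) (hh : ∀ i, 0 < h i)
    (hsum : (∑ l, γ l / (1 + γ l)) < 1)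
    (pstar : S → ℝ)
    (hpstar : ∀ i, pstar i =
      σ2 / h i * ((γ i / (1 + γ i)) / (1 - ∑ l, γ l / (1 + γ l)))) :
    FeasiblePow σ2 γ h pstar ∧
    (∀ q : S → ℝ, FeasiblePow σ2 γ h q → ∀ i, pstar i ≤ q i) ∧
    ParetoEffPow σ2 γ h pstar ∧
    (∀ p : S → ℝ, ParetoEffPow σ2 γ h p → p = pstar) := by
  set B := ∑ l, γ l / (1 + γ l) with hB
  have hB1 : 0 < 1 - B := by linarith
  have hβ : ∀ i, 0 < γ i / (1 + γ i) := fun i => div_pos (hγ i) (by linarith [hγ i])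
  have hpos : ∀ i, 0 < pstar i := fun i => by
    rw [hpstar]
    exact mul_pos (div_pos hσ (hh i)) (div_pos (hβ i) hB1)
  have hhp : ∀ i, h i * pstar i = γ i / (1 + γ i) * (σ2 / (1 - B)) := fun i => by
    rw [hpstar]
    generalize γ i / (1 + γ i) = b
    have := (hh i).ne'
    field_simp
  have hT : (∑ l, h l * pstar l) + σ2 = σ2 / (1 - B) := by
    simp only [hhp]
    rw [← Finset.sum_mul, ← hB]
    field_simp
    ring
  have hfeas : FeasiblePow σ2 γ h pstar := by
    rw [feasiblePow_iff_aux σ2 hσ γ h hγ hh pstar hpos]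
    intro i
    rw [hT, hhp]
  have hmin : ∀ q : S → ℝ, FeasiblePow σ2 γ h q → ∀ i, pstar i ≤ q i := by
    intro q hq i
    have H := (feasiblePow_iff_aux σ2 hσ γ h hγ hh q hq.1).1 hq
    have hs := Finset.sum_le_sum fun i (_ : i ∈ Finset.univ) => H i
    rw [← Finset.sum_mul, ← hB] at hs
    have h1 : σ2 / (1 - B) ≤ (∑ l, h l * q l) + σ2 := by
      rw [div_le_iff₀ hB1]
      linarith
    have h2 := mul_le_mul_of_nonneg_left h1 (hβ i).le
    rw [← hhp] at h2
    exact le_of_mul_le_mul_left (h2.trans (H i)) (hh i)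
  refine ⟨hfeas, hmin, ⟨hfeas, ?_⟩, ?_⟩
  · rintro ⟨q, hq, -, i, hi⟩
    exact absurd (hmin q hq i) (not_le.2 hi)
  · rintro p ⟨hp, hn⟩
    funext i
    by_contra hne
    exact hn ⟨pstar, hfeas, hmin p hp, i, lt_of_le_of_ne (hmin p hp i) (Ne.symm hne)⟩
end

section
/- Suppose all mobiles are collocated and all base stations are symmetrically placed with single class traffic: h_{ij} = h > 0 and β_i = β ∈ (0,1) for all i ∈ M, j ∈ N, and suppose at least one association profile gives every mobile finite cost. Then every Nash equilibrium a of the base station association game (M, N, (c_i)) is system optimal, i.e., it minimizes C(a) = Σ_{i ∈ M} c_i(a) over all association profiles. Equivalently, writing n = ⌊|M|/|N|⌋, at every Nash equilibrium each base station serves either n or n+1 mobiles, and every such profile minimizes C. -/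
open scoped BigOperators ENNReal

/-- Number of mobiles associated with base station `j` under profile `a`. -/
def mcount {M N : Type*} [Fintype M] [DecidableEq N] (a : M → N) (j : N) : ℕ :=
  (Finset.univ.filter (fun l => a l = j)).card

/-- Cost of mobile `i` under profile `a` for single class traffic (common load `β`) and
identical gains `h`: `(σ²β/h)/(1 − |M_{a_i}(a)|β)` when `|M_{a_i}(a)|β < 1`, else `+∞`. -/
noncomputable def mcost {M N : Type*} [Fintype M] [DecidableEq N]
    (σ2 β h : ℝ) (a : M → N) (i : M) : ℝ≥0∞ :=
  if (mcount a (a i) : ℝ) * β < 1 then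
    ENNReal.ofReal (σ2 * β / h / (1 - (mcount a (a i) : ℝ) * β))
  else ⊤

/-- System cost `C(a) = ∑_i c_i(a)`. -/
noncomputable def sysCost {M N : Type*} [Fintype M] [DecidableEq N]
    (σ2 β h : ℝ) (a : M → N) : ℝ≥0∞ :=
  ∑ i, mcost σ2 β h a i

/-- `a` is a Nash equilibrium: no mobile can strictly decrease its cost by unilaterally
switching base stations. -/
def IsNE {M N : Type*} [Fintype M] [DecidableEq M] [DecidableEq N]
    (σ2 β h : ℝ) (a : M → N) : Prop :=
  ∀ (i : M) (j : N), mcost σ2 β h a i ≤ mcost σ2 β h (Function.update a i j) i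

theorem sum_mcount {M N : Type*} [Fintype M] [Fintype N] [DecidableEq N] (a : M → N) :
    ∑ j, mcount a j = Fintype.card M := by
  unfold mcount
  rw [← Finset.card_univ]
  exact (Finset.card_eq_sum_card_fiberwise (fun _ _ => Finset.mem_univ _)).symm

theorem mcount_update {M N : Type*} [Fintype M] [DecidableEq M] [DecidableEq N]
    (a : M → N) (i : M) (j : N) (hij : a i ≠ j) :
    mcount (Function.update a i j) j = mcount a j + 1 := by
  unfold mcount
  have : (Finset.univ.filter (fun l => Function.update a i j l = j))
      = insert i (Finset.univ.filter (fun l => a l = j)) := by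
    ext l
    by_cases hl : l = i
    · subst hl; simp
    · simp [Function.update_of_ne hl, hl]
  rw [this, Finset.card_insert_of_notMem (by simp [hij])]

theorem exists_of_mcount_pos {M N : Type*} [Fintype M] [DecidableEq N]
    (a : M → N) (j : N) (hj : 0 < mcount a j) : ∃ i, a i = j := by
  obtain ⟨i, hi⟩ := Finset.card_pos.1 hj
  exact ⟨i, by simpa using hi⟩

theorem mcount_feas {M N : Type*} [Fintype M] [DecidableEq N] (σ2 β h : ℝ)
    (a : M → N) (ha : ∀ i, mcost σ2 β h a i < ⊤) (j : N) : (mcount a j : ℝ) * β < 1 := by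
  rcases Nat.eq_zero_or_pos (mcount a j) with h0 | h0
  · simp [h0]
  · obtain ⟨i, rfl⟩ := exists_of_mcount_pos a j h0
    by_contra hc
    have := ha i
    simp [mcost, hc] at this

theorem sysCost_eq {M N : Type*} [Fintype M] [Fintype N] [DecidableEq N] (σ2 β h : ℝ)
    (hc : 0 < σ2 * β / h)
    (a : M → N) (ha : ∀ j, (mcount a j : ℝ) * β < 1) :
    sysCost σ2 β h a = ENNReal.ofReal
      (∑ j, (mcount a j : ℝ) * (σ2 * β / h / (1 - (mcount a j : ℝ) * β))) := by
  have h1 : ∑ j, (mcount a j : ℝ) * (σ2 * β / h / (1 - (mcount a j : ℝ) * β))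
      = ∑ i, (σ2 * β / h / (1 - (mcount a (a i) : ℝ) * β)) := by
    rw [← Finset.sum_fiberwise (s := Finset.univ) (g := a)]
    refine Finset.sum_congr rfl fun j _ => ?_
    rw [Finset.sum_congr rfl (g := fun _ => σ2 * β / h / (1 - (mcount a j : ℝ) * β))]
    · rw [Finset.sum_const, nsmul_eq_mul]; rfl
    · intro x hx
      rw [(Finset.mem_filter.1 hx).2]
  rw [h1, ENNReal.ofReal_sum_of_nonneg]
  · unfold sysCost
    refine Finset.sum_congr rfl fun i _ => ?_
    simp [mcost, ha (a i)]
  · intro i _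
    have := ha (a i)
    exact div_nonneg hc.le (by linarith)

theorem tangent_ineq (c β : ℝ) (hc : 0 < c) (hβ : 0 < β) (n z : ℕ)
    (hn : ((n : ℝ) + 1) * β < 1) (hz : (z : ℝ) * β < 1) :
    n * (c / (1 - n * β)) + ((z : ℝ) - n) * (c / ((1 - (n + 1) * β) * (1 - n * β)))
      ≤ z * (c / (1 - z * β)) := by
  have p1 : 0 < 1 - ((n : ℝ) + 1) * β := by linarith
  have p2 : 0 < 1 - (n : ℝ) * β := by nlinarith
  have p3 : 0 < 1 - (z : ℝ) * β := by linarith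
  have key : 0 ≤ ((z : ℝ) - n) * ((z : ℝ) - n - 1) := by
    rcases Nat.lt_or_ge n z with hlt | hge
    · have : (n : ℝ) + 1 ≤ z := by exact_mod_cast hlt
      nlinarith
    · have : (z : ℝ) ≤ n := by exact_mod_cast hge
      nlinarith
  have e : z * (c / (1 - z * β)) - (n * (c / (1 - n * β))
      + ((z : ℝ) - n) * (c / ((1 - (n + 1) * β) * (1 - n * β))))
      = c * β * (((z : ℝ) - n) * ((z : ℝ) - n - 1)) /
        ((1 - (n + 1) * β) * (1 - n * β) * (1 - z * β)) := by
    have q1 := p1.ne'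
    have q2 := p2.ne'
    have q3 := p3.ne'
    generalize hA : 1 - ((n : ℝ) + 1) * β = A at *
    generalize hB : 1 - (n : ℝ) * β = B at *
    generalize hC : 1 - (z : ℝ) * β = C at *
    field_simp
    subst hA hB hC
    ring
  have : 0 ≤ c * β * (((z : ℝ) - n) * ((z : ℝ) - n - 1)) /
        ((1 - (n + 1) * β) * (1 - n * β) * (1 - z * β)) := by positivity
  linarith

theorem tangent_eq (c β : ℝ) (hβ : 0 < β) (n z : ℕ)
    (hn : ((n : ℝ) + 1) * β < 1) (hz : z = n ∨ z = n + 1) :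
    n * (c / (1 - n * β)) + ((z : ℝ) - n) * (c / ((1 - (n + 1) * β) * (1 - n * β)))
      = z * (c / (1 - z * β)) := by
  have p1 : 0 < 1 - ((n : ℝ) + 1) * β := by linarith
  have p2 : 0 < 1 - (n : ℝ) * β := by nlinarith
  rcases hz with rfl | rfl
  · simp
  · push_cast
    have q1 := p1.ne'
    have q2 := p2.ne'
    generalize hA : 1 - ((n : ℝ) + 1) * β = A at *
    generalize hB : 1 - (n : ℝ) * β = B at *
    field_simp
    subst hA hB
    ring

theorem balanced_opt {M N : Type*} [Fintype M] [Fintype N] [DecidableEq N]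
    (σ2 β h : ℝ) (hc : 0 < σ2 * β / h) (hβ0 : 0 < β) (n : ℕ) (a a' : M → N)
    (ha : ∀ j : N, mcount a j = n ∨ mcount a j = n + 1) :
    sysCost σ2 β h a ≤ sysCost σ2 β h a' := by
  by_cases hf : ∀ i, mcost σ2 β h a' i < ⊤
  swap
  · push Not at hf
    obtain ⟨i, hi⟩ := hf
    have : sysCost σ2 β h a' = ⊤ :=
      ENNReal.sum_eq_top.2 ⟨i, Finset.mem_univ _, top_le_iff.1 hi⟩
    rw [this]; exact le_top
  have hz := mcount_feas σ2 β h a' hf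
  have hs : ∑ j, mcount a j = ∑ j, mcount a' j := by rw [sum_mcount, sum_mcount]
  have hsr : ∑ j, (mcount a j : ℝ) = ∑ j, (mcount a' j : ℝ) := by exact_mod_cast hs
  by_cases hn : ((n : ℝ) + 1) * β < 1
  · have hy : ∀ j, (mcount a j : ℝ) * β < 1 := by
      intro j
      rcases ha j with e | e <;> rw [e] <;> push_cast <;> nlinarith
    rw [sysCost_eq σ2 β h hc a hy, sysCost_eq σ2 β h hc a' hz]
    apply ENNReal.ofReal_le_ofReal
    calc _ = ∑ j, ((n : ℝ) * (σ2 * β / h / (1 - n * β)) + ((mcount a j : ℝ) - n) *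
              (σ2 * β / h / ((1 - (n + 1) * β) * (1 - n * β)))) :=
          Finset.sum_congr rfl fun j _ => (tangent_eq _ β hβ0 n _ hn (ha j)).symm
      _ = ∑ j, ((n : ℝ) * (σ2 * β / h / (1 - n * β)) + ((mcount a' j : ℝ) - n) *
              (σ2 * β / h / ((1 - (n + 1) * β) * (1 - n * β)))) := by
          simp only [Finset.sum_add_distrib, ← Finset.sum_mul, Finset.sum_sub_distrib, hsr]
      _ ≤ _ := Finset.sum_le_sum fun j _ => tangent_ineq _ β hc hβ0 n _ hn (hz j)
  · have hle : ∀ j ∈ Finset.univ, mcount a' j ≤ mcount a j := by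
      intro j _
      have h1 : (mcount a' j : ℝ) < n + 1 := by
        have := hz j
        by_contra hcon
        push Not at hcon
        nlinarith
      have h2 : mcount a' j < n + 1 := by exact_mod_cast h1
      rcases ha j with e | e <;> omega
    have heq := (Finset.sum_eq_sum_iff_of_le hle).1 hs.symm
    have hy : ∀ j, (mcount a j : ℝ) * β < 1 := by
      intro j
      rw [← heq j (Finset.mem_univ _)]; exact hz j
    rw [sysCost_eq σ2 β h hc a hy, sysCost_eq σ2 β h hc a' hz]
    apply le_of_eq
    congr 1
    exact Finset.sum_congr rfl fun j hj => by rw [heq j hj]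

theorem ne_balanced {M N : Type*} [Fintype M] [DecidableEq M] [Fintype N] [DecidableEq N]
    (σ2 β h : ℝ) (hc : 0 < σ2 * β / h) (hβ0 : 0 < β)
    (hfeas : ∃ a₀ : M → N, ∀ i, mcost (M := M) (N := N) σ2 β h a₀ i < ⊤)
    (a : M → N) (hne : IsNE σ2 β h a) (j : N) :
    mcount a j = Fintype.card M / Fintype.card N ∨
      mcount a j = Fintype.card M / Fintype.card N + 1 := by
  obtain ⟨a₀, h₀⟩ := hfeas
  have hz := mcount_feas σ2 β h a₀ h₀
  obtain ⟨m, -, hm⟩ := Finset.exists_min_image Finset.univ (mcount a) ⟨j, Finset.mem_univ _⟩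
  have hup : ∀ k, mcount a k ≤ mcount a m + 1 := by
    intro k
    by_contra hk
    push Not at hk
    obtain ⟨i, hi⟩ := exists_of_mcount_pos a k (by omega)
    have hkm : a i ≠ m := by
      rw [hi]; rintro rfl; omega
    have hN := hne i m
    unfold mcost at hN
    rw [Function.update_self, mcount_update a i m hkm, hi] at hN
    have hkr : (mcount a m : ℝ) + 1 + 1 ≤ mcount a k := by exact_mod_cast hk
    have hover : ¬ (((mcount a m + 1 : ℕ) : ℝ) * β < 1) := by
      intro hlt
      rw [if_pos hlt] at hN
      push_cast at hlt hN
      by_cases hk1 : (mcount a k : ℝ) * β < 1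
      · rw [if_pos hk1] at hN
        have p3 : 0 < 1 - (mcount a k : ℝ) * β := by linarith
        have p4 : 0 < 1 - ((mcount a m : ℝ) + 1) * β := by linarith
        rw [ENNReal.ofReal_le_ofReal_iff (div_nonneg hc.le p4.le)] at hN
        have := div_lt_div_of_pos_left hc p3
          (show 1 - (mcount a k : ℝ) * β < 1 - ((mcount a m : ℝ) + 1) * β by nlinarith)
        linarith
      · rw [if_neg hk1] at hN
        simp at hN
    have hle : ∀ l, mcount a₀ l ≤ mcount a m := by
      intro l
      by_contra hcon
      push Not at hcon
      have h1 : ((mcount a m + 1 : ℕ) : ℝ) ≤ mcount a₀ l := by exact_mod_cast hcon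
      have := hz l
      apply hover
      nlinarith
    have hlt : ∑ l, mcount a₀ l < ∑ l, mcount a l :=
      Finset.sum_lt_sum (fun l _ => (hle l).trans (hm l (Finset.mem_univ _)))
        ⟨k, Finset.mem_univ _, by have := hle k; omega⟩
    rw [sum_mcount, sum_mcount] at hlt
    exact lt_irrefl _ hlt
  have hdiv : Fintype.card M / Fintype.card N = mcount a m := by
    have hpos : 0 < Fintype.card N := Fintype.card_pos_iff.2 ⟨j⟩
    apply Nat.div_eq_of_lt_le
    · rw [← sum_mcount a]
      have := Finset.card_nsmul_le_sum Finset.univ (mcount a) (mcount a m) hm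
      simpa [mul_comm] using this
    · rw [← sum_mcount a]
      have : ∑ l, mcount a l < ∑ _l : N, (mcount a m + 1) :=
        Finset.sum_lt_sum (fun l _ => hup l) ⟨m, Finset.mem_univ _, by omega⟩
      simpa [mul_comm] using this
  rw [hdiv]
  have := hup j
  have := hm j (Finset.mem_univ _)
  omega

/-- Collocated mobiles, symmetrically placed base stations and single class traffic
(`h_{ij} = h`, `β_i = β`): every Nash equilibrium is system optimal; equivalently, at
every Nash equilibrium each base station serves either `n = ⌊|M|/|N|⌋` or `n+1` mobiles,
and every profile with this property minimizes the system cost. -/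
theorem symmetric_ne_system_optimal {M N : Type*}
    [Fintype M] [DecidableEq M] [Fintype N] [DecidableEq N]
    (σ2 : ℝ) (hσ : 0 < σ2) (β : ℝ) (hβ0 : 0 < β) (hβ1 : β < 1)
    (h : ℝ) (hh : 0 < h)
    (hfeas : ∃ a₀ : M → N, ∀ i, mcost (M := M) (N := N) σ2 β h a₀ i < ⊤)
    (n : ℕ) (hn : n = Fintype.card M / Fintype.card N) :
    (∀ a : M → N, IsNE σ2 β h a → ∀ a' : M → N, sysCost σ2 β h a ≤ sysCost σ2 β h a') ∧
    (∀ a : M → N, IsNE σ2 β h a → ∀ j : N, mcount a j = n ∨ mcount a j = n + 1) ∧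
    (∀ a : M → N, (∀ j : N, mcount a j = n ∨ mcount a j = n + 1) →
      ∀ a' : M → N, sysCost σ2 β h a ≤ sysCost σ2 β h a') := by
  have hc : 0 < σ2 * β / h := by positivity
  subst hn
  exact ⟨fun a ha a' => balanced_opt σ2 β h hc hβ0 _ a a'
      (ne_balanced σ2 β h hc hβ0 hfeas a ha),
    fun a ha => ne_balanced σ2 β h hc hβ0 hfeas a ha,
    fun a ha a' => balanced_opt σ2 β h hc hβ0 _ a a' ha⟩
end

section
/- Consider the nonatomic power control problem at a single base station: a measure space (X, μ) of nonatomic mobiles, measurable functions γ : X → ℝ with γ(x) > 0 (target SINR density) and h : X → ℝ with h(x) > 0 (power gain), noise power σ² > 0, and 0 < ∫_X γ dμ < ∞. A measurable power density p : X → ℝ with p(x) > 0 a.e. and ∫_X p·h dμ < ∞ is feasible if p(x) h(x) ≥ γ(x) (∫_X p·h dμ + σ²) for μ-almost every x. Then a feasible power density exists if and only if ∫_X γ dμ < 1. -/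
open MeasureTheory

/-- `p` is a feasible power density for the nonatomic single base station power control
problem: `p` is measurable, a.e. positive, `p·h` is integrable, and the SINR density
requirement `p(x)h(x) ≥ γ(x)(∫ p·h dμ + σ²)` holds for a.e. `x`. -/
def FeasiblePD {X : Type*} [MeasurableSpace X] (μ : Measure X)
    (γ h : X → ℝ) (σ2 : ℝ) (p : X → ℝ) : Prop :=
  Measurable p ∧ (∀ᵐ x ∂μ, 0 < p x) ∧ Integrable (fun x => p x * h x) μ ∧
  ∀ᵐ x ∂μ, γ x * ((∫ y, p y * h y ∂μ) + σ2) ≤ p x * h x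

/-- A feasible power density exists iff `∫ γ dμ < 1`. -/
theorem nonatomic_feasible_iff {X : Type*} [MeasurableSpace X] (μ : Measure X)
    (γ h : X → ℝ) (hγm : Measurable γ) (hhm : Measurable h)
    (hγpos : ∀ x, 0 < γ x) (hhpos : ∀ x, 0 < h x)
    (σ2 : ℝ) (hσ : 0 < σ2)
    (hγint : Integrable γ μ) (hγposint : 0 < ∫ x, γ x ∂μ) :
    (∃ p : X → ℝ, FeasiblePD μ γ h σ2 p) ↔ (∫ x, γ x ∂μ) < 1 := by
  constructor
  · rintro ⟨p, -, hp, hint, hle⟩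
    have h1 := integral_mono_ae (hγint.mul_const _) hint hle
    rw [integral_mul_const] at h1
    have h0 : 0 ≤ ∫ y, p y * h y ∂μ := by
      apply integral_nonneg_of_ae
      filter_upwards [hp] with x hx
      exact (mul_pos hx (hhpos x)).le
    by_contra hc
    rw [not_lt] at hc
    nlinarith
  · intro hG
    have hd : 0 < 1 - ∫ x, γ x ∂μ := by linarith
    have hc : 0 < σ2 / (1 - ∫ x, γ x ∂μ) := div_pos hσ hd
    have he : (∫ x, γ x ∂μ) * (σ2 / (1 - ∫ x, γ x ∂μ)) + σ2 = σ2 / (1 - ∫ x, γ x ∂μ) := by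
      field_simp
      ring
    generalize σ2 / (1 - ∫ x, γ x ∂μ) = c at hc he
    have hph : ∀ x, γ x * c / h x * h x = γ x * c := fun x =>
      div_mul_cancel₀ _ (hhpos x).ne'
    refine ⟨fun x => γ x * c / h x, (hγm.mul_const c).div hhm,
      Filter.Eventually.of_forall fun x => div_pos (mul_pos (hγpos x) hc) (hhpos x), ?_, ?_⟩
    · simp only [hph]
      exact hγint.mul_const c
    · simp only [hph]
      rw [integral_mul_const, he]
      exact Filter.Eventually.of_forall fun x => le_rfl
end

section
/- Consider the nonatomic power control problem at a single base station with measure space (X, μ), measurable γ, h : X → ℝ positive, noise σ² > 0, 0 < ∫_X γ dμ < 1. Define p(x) = γ(x) σ² / (h(x) (1 − ∫_X γ dμ)). Then: (i) p is feasible; (ii) every feasible power density q satisfies ∫_X q·h dμ ≥ σ² (∫_X γ dμ) / (1 − ∫_X γ dμ); (iii) p is Pareto efficient, i.e., there is no feasible q with q ≤ p a.e. and q < p on a set of positive measure; and (iv) p is the unique Pareto efficient feasible power density up to a.e. equality. -/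
open MeasureTheory

/-- A feasible `p` is Pareto efficient if no feasible `q` satisfies `q ≤ p` a.e. with
`q < p` on a set of positive measure. -/
def ParetoEffPD {X : Type*} [MeasurableSpace X] (μ : Measure X)
    (γ h : X → ℝ) (σ2 : ℝ) (p : X → ℝ) : Prop :=
  FeasiblePD μ γ h σ2 p ∧
  ¬ ∃ q : X → ℝ, FeasiblePD μ γ h σ2 q ∧ (∀ᵐ x ∂μ, q x ≤ p x) ∧
    μ {x | q x < p x} ≠ 0

/-- When `0 < ∫ γ dμ < 1`, the power density `p(x) = γ(x)σ²/(h(x)(1 − ∫γ dμ))` is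
feasible, `∫ q·h dμ ≥ σ²(∫γ dμ)/(1 − ∫γ dμ)` for every feasible `q`, `p` is Pareto
efficient, and `p` is the unique Pareto efficient feasible power density up to a.e.
equality. -/
theorem nonatomic_pareto_power {X : Type*} [MeasurableSpace X] (μ : Measure X)
    (γ h : X → ℝ) (hγm : Measurable γ) (hhm : Measurable h)
    (hγpos : ∀ x, 0 < γ x) (hhpos : ∀ x, 0 < h x)
    (σ2 : ℝ) (hσ : 0 < σ2)
    (hγint : Integrable γ μ) (hγposint : 0 < ∫ x, γ x ∂μ)
    (hγlt : (∫ x, γ x ∂μ) < 1)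
    (p : X → ℝ)
    (hp : ∀ x, p x = γ x * σ2 / (h x * (1 - ∫ y, γ y ∂μ))) :
    FeasiblePD μ γ h σ2 p ∧
    (∀ q : X → ℝ, FeasiblePD μ γ h σ2 q →
      σ2 * (∫ x, γ x ∂μ) / (1 - ∫ x, γ x ∂μ) ≤ ∫ x, q x * h x ∂μ) ∧
    ParetoEffPD μ γ h σ2 p ∧
    (∀ q : X → ℝ, ParetoEffPD μ γ h σ2 q → q =ᵐ[μ] p) := by
  have hG : 0 < 1 - ∫ y, γ y ∂μ := by linarith
  generalize hGe : (∫ y, γ y ∂μ) = G at *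
  have hph : ∀ x, p x * h x = γ x * (σ2 / (1 - G)) := by
    intro x
    have := (hhpos x).ne'
    have := hG.ne'
    rw [hp]
    field_simp
  have hint : ∫ x, p x * h x ∂μ = G * (σ2 / (1 - G)) := by
    simp_rw [hph]
    rw [integral_mul_const, hGe]
  have hfeas : FeasiblePD μ γ h σ2 p := by
    refine ⟨?_, ?_, ?_, ?_⟩
    · have : p = fun x => γ x * σ2 / (h x * (1 - G)) := funext hp
      rw [this]
      fun_prop
    · refine Filter.Eventually.of_forall fun x => ?_
      rw [hp]
      have := hγpos x
      have := hhpos x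
      positivity
    · simp_rw [hph]
      exact hγint.mul_const _
    · refine Filter.Eventually.of_forall fun x => ?_
      rw [hint, hph]
      apply le_of_eq
      have := hG.ne'
      field_simp
      ring
  have hlow : ∀ q : X → ℝ, FeasiblePD μ γ h σ2 q →
      σ2 * G / (1 - G) ≤ ∫ x, q x * h x ∂μ := by
    rintro q ⟨-, -, hqi, hq⟩
    have h1 := integral_mono_ae (hγint.mul_const _) hqi hq
    rw [integral_mul_const, hGe] at h1
    rw [div_le_iff₀ hG]
    nlinarith
  have hge : ∀ q : X → ℝ, FeasiblePD μ γ h σ2 q → ∀ᵐ x ∂μ, p x ≤ q x := by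
    intro q hq
    have h1 := hlow q hq
    have h2 : σ2 / (1 - G) ≤ (∫ x, q x * h x ∂μ) + σ2 := by
      have : σ2 / (1 - G) = σ2 * G / (1 - G) + σ2 := by
        have := hG.ne'
        field_simp
        ring
      linarith
    filter_upwards [hq.2.2.2] with x hx
    refine le_of_mul_le_mul_right ?_ (hhpos x)
    rw [hph]
    exact (mul_le_mul_of_nonneg_left h2 (hγpos x).le).trans hx
  refine ⟨hfeas, hlow, ⟨hfeas, ?_⟩, ?_⟩
  · rintro ⟨q, hq, -, hne⟩
    apply hne
    have := hge q hq
    rw [ae_iff] at this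
    simpa only [not_le] using this
  · rintro q ⟨hq, hno⟩
    have h0 : μ {x | p x < q x} = 0 := by
      by_contra hne
      exact hno ⟨p, hfeas, hge q hq, hne⟩
    have h1 : ∀ᵐ x ∂μ, q x ≤ p x := by
      rw [ae_iff]
      simpa only [not_le] using h0
    filter_upwards [h1, hge q hq] with x a b
    exact le_antisymm a b
end

section
/- Consider the single-class nonatomic base station association game: a population of total mass M > 0 with common target SINR density γ > 0, a finite set N of base stations with gains h_j > 0, noise power σ² > 0, and feasibility γM < |N|. A congestion profile is a vector (m_j)_{j ∈ N} with m_j ≥ 0 and Σ_j m_j = M; the cost density at BS j is σ²γ/(h_j(1 − γ m_j)) if γ m_j < 1 and +∞ otherwise, and the system cost is C(m) = Σ_j m_j · σ²γ/(h_j(1 − γ m_j)). Let h_min = min_j h_j and h_max = max_j h_j. Then for every Nash equilibrium m (i.e., m_j > 0 implies σ²γ/(h_j(1 − γ m_j)) ≤ σ²γ/(h_k(1 − γ m_k)) for all k) and every congestion profile m°, C(m) ≤ (1/2)(1 + √(h_max/h_min)) · C(m°); that is, the price of anarchy is at most (1 + √(h_max/h_min))/2. -/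
open scoped BigOperators ENNReal

/-- Cost density at base station `j` in the single class nonatomic association game:
`σ²γ/(h_j(1 − γ m_j))` when `γ m_j < 1`, and `+∞` otherwise. -/
noncomputable def costD {N : Type*} (σ2 γ : ℝ) (hb : N → ℝ) (m : N → ℝ) (j : N) : ℝ≥0∞ :=
  if γ * m j < 1 then ENNReal.ofReal (σ2 * γ / (hb j * (1 - γ * m j))) else ⊤

/-- System cost `C(m) = ∑_j m_j · σ²γ/(h_j(1 − γ m_j))`. -/
noncomputable def CsysD {N : Type*} [Fintype N] (σ2 γ : ℝ) (hb : N → ℝ) (m : N → ℝ) : ℝ≥0∞ :=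
  ∑ j, ENNReal.ofReal (m j) * costD σ2 γ hb m j


lemma core_ineq {N : Type*} [Fintype N] [Nonempty N] (t y : N → ℝ) (p q : ℝ)
    (hp : 0 < p) (hq1 : q ≤ 1) (hpt : ∀ j, p ≤ t j) (htq : ∀ j, t j ≤ q)
    (hy : ∀ j, 0 < y j) (hsum : ∑ j, y j = ∑ j, t j ^ 2) :
    2 * p * ∑ j, (1 - t j ^ 2) ≤ (p + q) * ∑ j, (1 - y j) * t j ^ 2 / y j := by
  set S := ∑ j, t j ^ 2 with hS
  set T := ∑ j, t j with hT
  set n : ℝ := (Fintype.card N : ℝ) with hn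
  have hpq : p ≤ q := (hpt (Classical.arbitrary N)).trans (htq _)
  have hSpos : 0 < S := by
    rw [← hsum]; exact Finset.sum_pos (fun j _ => hy j) Finset.univ_nonempty
  have hnpos : 0 < n := by rw [hn]; exact_mod_cast Fintype.card_pos
  have h1 : ∑ j, (1 - t j ^ 2) = n - S := by
    rw [Finset.sum_sub_distrib]; simp [hn, hS]
  have h2 : ∑ j, (1 - y j) * t j ^ 2 / y j = ∑ j, t j ^ 2 / y j - S := by
    rw [hS, ← Finset.sum_sub_distrib]
    refine Finset.sum_congr rfl fun j _ => ?_
    have := (hy j).ne'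
    field_simp
  have h3 : T ^ 2 / S ≤ ∑ j, t j ^ 2 / y j := by
    have := Finset.sq_sum_div_le_sum_sq_div Finset.univ t (g := y) (fun j _ => hy j)
    rwa [hsum] at this
  have h4 : S + n * (p * q) ≤ (p + q) * T := by
    have : 0 ≤ ∑ j, (t j - p) * (q - t j) :=
      Finset.sum_nonneg fun j _ => mul_nonneg (by linarith [hpt j]) (by linarith [htq j])
    have e : ∑ j, (t j - p) * (q - t j) = (p + q) * T - S - n * (p * q) := by
      have : ∀ j, (t j - p) * (q - t j) = (p + q) * t j - t j ^ 2 - p * q := fun j => by ring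
      simp only [this, Finset.sum_sub_distrib, ← Finset.mul_sum]
      simp [hn, hS, hT]
      ring
    linarith
  rw [h1, h2]
  have hpq0 : 0 < p + q := by linarith
  have h5 : (S + n * (p * q)) ^ 2 ≤ ((p + q) * T) ^ 2 := by
    have : 0 ≤ n * (p * q) := mul_nonneg hnpos.le (mul_nonneg hp.le (hp.le.trans hpq))
    exact pow_le_pow_left₀ (by linarith) h4 2
  have hA : 0 < 1 + p ^ 2 - q ^ 2 := by nlinarith
  have h6 : 0 ≤ (1 + p ^ 2 - q ^ 2) * S ^ 2 - 2 * p ^ 2 * S * n + p ^ 2 * q ^ 2 * n ^ 2 := by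
    have : 0 ≤ (1 + p ^ 2 - q ^ 2) * ((1 + p ^ 2 - q ^ 2) * S ^ 2 - 2 * p ^ 2 * S * n
        + p ^ 2 * q ^ 2 * n ^ 2) := by
      have e : (1 + p ^ 2 - q ^ 2) * ((1 + p ^ 2 - q ^ 2) * S ^ 2 - 2 * p ^ 2 * S * n
        + p ^ 2 * q ^ 2 * n ^ 2) = ((1 + p ^ 2 - q ^ 2) * S - p ^ 2 * n) ^ 2
          + p ^ 2 * n ^ 2 * ((q ^ 2 - p ^ 2) * (1 - q ^ 2)) := by ring
      rw [e]
      have a1 : 0 ≤ q ^ 2 - p ^ 2 := by nlinarith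
      have a2 : 0 ≤ 1 - q ^ 2 := by nlinarith
      positivity
    exact nonneg_of_mul_nonneg_right this hA
  have h7 : 2 * p * (n - S) ≤ (p + q) * (T ^ 2 / S - S) := by
    have e : T ^ 2 / S - S = (T ^ 2 - S ^ 2) / S := by field_simp
    rw [e, ← mul_div_assoc, le_div_iff₀ hSpos]
    refine le_of_mul_le_mul_left ?_ hpq0
    nlinarith
  refine h7.trans ?_
  gcongr

/-- Price of anarchy bound for the single class nonatomic game: for every Nash
equilibrium `m` and every congestion profile `m°`,
`C(m) ≤ (1 + √(h_max/h_min))/2 · C(m°)`. -/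
theorem single_class_poa_bound {N : Type*} [Fintype N] [Nonempty N]
    (σ2 γ Mtot : ℝ) (hσ : 0 < σ2) (hγ : 0 < γ) (hM : 0 < Mtot)
    (hb : N → ℝ) (hhb : ∀ j, 0 < hb j)
    (hfeas : γ * Mtot < Fintype.card N)
    (m : N → ℝ) (hm0 : ∀ j, 0 ≤ m j) (hmsum : (∑ j, m j) = Mtot)
    (hNE : ∀ j k : N, 0 < m j → costD σ2 γ hb m j ≤ costD σ2 γ hb m k)
    (m' : N → ℝ) (hm'0 : ∀ j, 0 ≤ m' j) (hm'sum : (∑ j, m' j) = Mtot) :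
    CsysD σ2 γ hb m ≤
      ENNReal.ofReal
        ((1 + Real.sqrt ((Finset.univ.sup' Finset.univ_nonempty hb) /
            (Finset.univ.inf' Finset.univ_nonempty hb))) / 2) *
        CsysD σ2 γ hb m' := by
  classical
  set H := Finset.univ.sup' Finset.univ_nonempty hb with hH
  set L := Finset.univ.inf' Finset.univ_nonempty hb with hL
  have hleH : ∀ j, hb j ≤ H := fun j => Finset.le_sup' hb (Finset.mem_univ j)
  have hLle : ∀ j, L ≤ hb j := fun j => Finset.inf'_le hb (Finset.mem_univ j)
  have hL0 : 0 < L := by rw [hL, Finset.lt_inf'_iff]; exact fun j _ => hhb j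
  have hH0 : 0 < H := (hhb (Classical.arbitrary N)).trans_le (hleH _)
  set K := (1 + Real.sqrt (H / L)) / 2 with hK
  have hK0 : 0 < K := by positivity
  -- the alternative profile may be taken feasible
  by_cases hf' : ∀ j, γ * m' j < 1
  swap
  · push Not at hf'
    obtain ⟨j, hj⟩ := hf'
    have hmj : 0 < m' j := by
      by_contra hcon
      have : m' j = 0 := le_antisymm (not_lt.mp hcon) (hm'0 j)
      rw [this] at hj; linarith
    have htop : CsysD σ2 γ hb m' = ⊤ := by
      unfold CsysD
      rw [ENNReal.sum_eq_top]
      refine ⟨j, Finset.mem_univ j, ?_⟩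
      simp only [costD, not_lt.mpr hj, if_false]
      exact ENNReal.mul_top (by simpa using hmj)
    rw [htop, ENNReal.mul_top (by simpa using hK0)]
    exact le_top
  -- the equilibrium is feasible
  have hf : ∀ j, γ * m j < 1 := by
    by_contra hcon
    push Not at hcon
    obtain ⟨j, hj⟩ := hcon
    have hmj : 0 < m j := by
      by_contra hcon
      have : m j = 0 := le_antisymm (not_lt.mp hcon) (hm0 j)
      rw [this] at hj; linarith
    have hall : ∀ k, 1 ≤ γ * m k := by
      intro k
      by_contra hk
      have h := hNE j k hmj
      simp only [costD, not_lt.mpr hj, if_false, not_le.mp hk, if_true] at h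
      exact ENNReal.ofReal_ne_top (top_le_iff.mp h)
    have : (Fintype.card N : ℝ) ≤ ∑ k, γ * m k := by
      have := Finset.sum_le_sum (s := Finset.univ) fun k _ => hall k
      simpa using this
    rw [← Finset.mul_sum, hmsum] at this
    linarith
  have hreal : ∀ x : N → ℝ, (∀ j, 0 ≤ x j) → (∀ j, γ * x j < 1) →
      CsysD σ2 γ hb x = ENNReal.ofReal (∑ j, x j * (σ2 * γ / (hb j * (1 - γ * x j)))) := by
    intro x hx0 hx1
    have hpos : ∀ j, 0 ≤ σ2 * γ / (hb j * (1 - γ * x j)) := fun j => by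
      have := hhb j
      have h2 : 0 < 1 - γ * x j := by linarith [hx1 j]
      positivity
    rw [ENNReal.ofReal_sum_of_nonneg fun j _ => mul_nonneg (hx0 j) (hpos j)]
    unfold CsysD costD
    refine Finset.sum_congr rfl fun j _ => ?_
    rw [if_pos (hx1 j), ENNReal.ofReal_mul (hx0 j)]
  rw [hreal m hm0 hf, hreal m' hm'0 hf', ← ENNReal.ofReal_mul hK0.le]
  apply ENNReal.ofReal_le_ofReal
  have hb1 : ∀ j, 0 < 1 - γ * m j := fun j => by linarith [hf j]
  have hy : ∀ j, 0 < 1 - γ * m' j := fun j => by linarith [hf' j]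
  have hD : ∀ j k, 0 < m j → hb k * (1 - γ * m k) ≤ hb j * (1 - γ * m j) := by
    intro j k hj
    have h := hNE j k hj
    have pj := mul_pos (hhb j) (hb1 j)
    have pk := mul_pos (hhb k) (hb1 k)
    simp only [costD, hf, if_true] at h
    rw [ENNReal.ofReal_le_ofReal_iff (by positivity)] at h
    exact (div_le_div_iff_of_pos_left (by positivity) pj pk).mp h
  obtain ⟨i, hi⟩ : ∃ i, 0 < m i := by
    by_contra hcon
    push Not at hcon
    have := Finset.sum_nonpos (s := Finset.univ) fun k _ => hcon k
    linarith
  set μ := hb i * (1 - γ * m i) with hμ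
  have hμ0 : 0 < μ := mul_pos (hhb i) (hb1 i)
  have hle : ∀ k, hb k * (1 - γ * m k) ≤ μ := fun k => hD i k hi
  have heq : ∀ k, 0 < m k → hb k * (1 - γ * m k) = μ := fun k hk =>
    le_antisymm (hle k) (hD k i hk)
  have hμH : μ ≤ H := by
    refine le_trans ?_ (hleH i)
    have := mul_nonneg (hhb i).le (mul_nonneg hγ.le (hm0 i))
    rw [hμ]; linarith
  -- cost of the equilibrium
  have hC : ∑ j, m j * (σ2 * γ / (hb j * (1 - γ * m j))) = σ2 / μ * ∑ j, γ * m j := by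
    rw [Finset.mul_sum]
    refine Finset.sum_congr rfl fun j _ => ?_
    rcases (hm0 j).eq_or_lt with h | h
    · simp [← h]
    · rw [heq j h]; ring
  set p := Real.sqrt (μ / H) with hp
  set q := min 1 (Real.sqrt (μ / L)) with hq
  have hp0 : 0 < p := Real.sqrt_pos.mpr (by positivity)
  set t : N → ℝ := fun j => Real.sqrt (1 - γ * m j) with ht
  have ht2 : ∀ j, t j ^ 2 = 1 - γ * m j := fun j => Real.sq_sqrt (hb1 j).le
  have hcore := core_ineq t (fun j => 1 - γ * m' j) p q hp0 (min_le_left _ _)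
    (fun j => by
      apply Real.sqrt_le_sqrt
      rcases (hm0 j).eq_or_lt with h | h
      · rw [← h, div_le_iff₀ hH0]; linarith
      · rw [div_le_iff₀ hH0, ← heq j h, mul_comm]
        exact mul_le_mul_of_nonneg_left (hleH j) (hb1 j).le)
    (fun j => by
      apply le_min
      · refine Real.sqrt_le_one.mpr ?_
        have := mul_nonneg hγ.le (hm0 j)
        linarith
      · apply Real.sqrt_le_sqrt
        rw [le_div_iff₀ hL0, mul_comm]
        exact (mul_le_mul_of_nonneg_right (hLle j) (hb1 j).le).trans (hle j))
    hy
    (by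
      simp only [ht2, Finset.sum_sub_distrib, ← Finset.mul_sum, hmsum, hm'sum])
  simp only [ht2, sub_sub_cancel] at hcore
  have hqK : p + q ≤ 2 * p * K := by
    have h1 : q ≤ p * Real.sqrt (H / L) := by
      rw [hp, ← Real.sqrt_mul (by positivity)]
      have : μ / H * (H / L) = μ / L := by field_simp
      rw [this]; exact min_le_right _ _
    rw [hK]; linarith
  have hW : 0 ≤ ∑ j, γ * m' j * (1 - γ * m j) / (1 - γ * m' j) :=
    Finset.sum_nonneg fun j _ =>
      div_nonneg (mul_nonneg (mul_nonneg hγ.le (hm'0 j)) (hb1 j).le) (hy j).le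
  have hfin : ∑ j, γ * m j ≤ K * ∑ j, γ * m' j * (1 - γ * m j) / (1 - γ * m' j) := by
    have := hcore.trans (mul_le_mul_of_nonneg_right hqK hW)
    refine le_of_mul_le_mul_left ?_ (show 0 < 2 * p by positivity)
    linarith
  have hC' : σ2 / μ * ∑ j, γ * m' j * (1 - γ * m j) / (1 - γ * m' j) ≤
      ∑ j, m' j * (σ2 * γ / (hb j * (1 - γ * m' j))) := by
    rw [Finset.mul_sum]
    refine Finset.sum_le_sum fun j _ => ?_
    have hyj := hy j
    have hhj := hhb j
    have h0 := hm'0 j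
    have e1 : σ2 / μ * (γ * m' j * (1 - γ * m j) / (1 - γ * m' j)) =
        (σ2 * γ * m' j / (1 - γ * m' j)) * ((1 - γ * m j) / μ) := by ring
    have e2 : m' j * (σ2 * γ / (hb j * (1 - γ * m' j))) =
        (σ2 * γ * m' j / (1 - γ * m' j)) * (1 / hb j) := by field_simp
    rw [e1, e2]
    apply mul_le_mul_of_nonneg_left _ (by positivity)
    rw [div_le_div_iff₀ hμ0 hhj]
    linarith [hle j]
  rw [hC]
  calc σ2 / μ * ∑ j, γ * m j
      ≤ σ2 / μ * (K * ∑ j, γ * m' j * (1 - γ * m j) / (1 - γ * m' j)) :=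
        mul_le_mul_of_nonneg_left hfin (by positivity)
    _ = K * (σ2 / μ * ∑ j, γ * m' j * (1 - γ * m j) / (1 - γ * m' j)) := by ring
    _ ≤ _ := mul_le_mul_of_nonneg_left hC' hK0.le
end
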